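/- Let μ₀ ∈ ℝ, σ₀ > 0 and τ_l < τ_u, let X be a random variable with the truncated normal distribution TN(μ₀,σ₀,τ_l,τ_u) and let F be its cumulative distribution function. Then ∫_{τ_l}^{τ_u} ∫_{τ_l}^{τ_u} ((x−μ₀)/σ₀)·((y−μ₀)/σ₀) · (F(min(x,y)) − F(x)F(y)) dx dy = (σ₀²/4)·( E[ ((X−μ₀)/σ₀)⁴ ] − ( E[ ((X−μ₀)/σ₀)² ] )² ). That is, the double integral equals the variance of (σ₀/2)((X−μ₀)/σ₀)². -/

import Mathlib

open Real

/-- The standard normal density `φ(x) = (1/√(2π)) e^{-x²/2}`. -/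
noncomputable def stdPhi (x : ℝ) : ℝ := (Real.sqrt (2 * Real.pi))⁻¹ * Real.exp (-(x ^ 2) / 2)

/-- The standard normal cumulative distribution function `Φ`. -/
noncomputable def stdPhiCDF (x : ℝ) : ℝ := ∫ t in Set.Iic x, stdPhi t

/-- The density of the truncated normal distribution `TN(μ,σ,τ_l,τ_u)` on `[τ_l, τ_u]`. -/
noncomputable def truncNormalPDF (μ σ τl τu : ℝ) (t : ℝ) : ℝ :=
  (1 / σ) * stdPhi ((t - μ) / σ) /
    (stdPhiCDF ((τu - μ) / σ) - stdPhiCDF ((τl - μ) / σ))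

open Set MeasureTheory

/-- Hoeffding's covariance identity for a single primitive `G` of `g` on `[a, b]`. -/
theorem integral_integral_mul_cdf_min_sub {a b : ℝ} (hab : a ≤ b) {f g G F : ℝ → ℝ}
    (hf : Continuous f) (hg : Continuous g) (hG : ∀ x, HasDerivAt G (g x) x)
    (hF : ∀ t, F t = ∫ s in a..t, f s) (hFb : F b = 1) :
    (∫ y in a..b, ∫ x in a..b, g x * g y * (F (min x y) - F x * F y)) =
      (∫ x in a..b, G x ^ 2 * f x) - (∫ x in a..b, G x * f x) ^ 2 := by
  have hGc : Continuous G := continuous_iff_continuousAt.2 fun x => (hG x).continuousAt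
  have hF' : ∀ x, HasDerivAt F (f x) x := by
    rw [funext hF]
    exact fun x => (hf.integral_hasStrictDerivAt a x).hasDerivAt
  have hFc : Continuous F := continuous_iff_continuousAt.2 fun x => (hF' x).continuousAt
  have hFa : F a = 0 := by rw [hF, intervalIntegral.integral_same]
  set M : ℝ → ℝ := fun t => ∫ s in a..t, G s * f s
  have hM' : ∀ x, HasDerivAt M (G x * f x) x := fun x =>
    ((hGc.mul hf).integral_hasStrictDerivAt a x).hasDerivAt
  have hMc : Continuous M := continuous_iff_continuousAt.2 fun x => (hM' x).continuousAt
  have hMa : M a = 0 := intervalIntegral.integral_same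
  have hgF : ∀ t, ∫ x in a..t, g x * F x = G t * F t - M t := by
    intro t
    rw [intervalIntegral.integral_eq_sub_of_hasDerivAt (f := fun x => G x * F x - M x)
      (f' := fun x => g x * F x)
      (fun x _ => (((hG x).mul (hF' x)).sub (hM' x)).congr_deriv (by ring))
      ((hg.mul hFc).intervalIntegrable _ _), hFa, hMa]
    ring
  have hmin : ∀ y ∈ Icc a b, ∫ x in a..b, g x * F (min x y) = G b * F y - M y := by
    intro y hy
    have hc : Continuous fun x => g x * F (min x y) := by fun_prop
    rw [← intervalIntegral.integral_add_adjacent_intervals (hc.intervalIntegrable a y) (hc.intervalIntegrable y b)]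
    have h1 : ∫ x in a..y, g x * F (min x y) = ∫ x in a..y, g x * F x := by
      refine intervalIntegral.integral_congr fun x hx => ?_
      rw [uIcc_of_le hy.1] at hx
      simp only [min_eq_left hx.2]
    have h2 : ∫ x in y..b, g x * F (min x y) = ∫ x in y..b, g x * F y := by
      refine intervalIntegral.integral_congr fun x hx => ?_
      rw [uIcc_of_le hy.2] at hx
      simp only [min_eq_right hx.1]
    rw [h1, h2, hgF, intervalIntegral.integral_mul_const,
      intervalIntegral.integral_eq_sub_of_hasDerivAt (fun x _ => hG x) (hg.intervalIntegrable _ _)]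
    ring
  have hinner : ∀ y ∈ Icc a b,
      ∫ x in a..b, g x * g y * (F (min x y) - F x * F y) = g y * (M b * F y - M y) := by
    intro y hy
    have hc : Continuous fun x => g x * F (min x y) := by fun_prop
    have hc' : Continuous fun x => g x * F x * F y := by fun_prop
    have h1 : ∀ x, g x * g y * (F (min x y) - F x * F y) =
        g y * (g x * F (min x y) - g x * F x * F y) := fun x => by ring
    simp only [h1]
    rw [intervalIntegral.integral_const_mul, intervalIntegral.integral_sub (hc.intervalIntegrable _ _) (hc'.intervalIntegrable _ _),
      intervalIntegral.integral_mul_const, hmin y hy, hgF, hFb]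
    ring
  rw [intervalIntegral.integral_congr (g := fun y => g y * (M b * F y - M y))
    fun y hy => hinner y (by rwa [uIcc_of_le hab] at hy)]
  have hc1 : Continuous fun y => g y * (M b * F y - M y) := by fun_prop
  have hc2 : Continuous fun y => M b * (G y * f y) - G y ^ 2 * f y := by fun_prop
  have key := intervalIntegral.integral_eq_sub_of_hasDerivAt (a := a) (b := b)
    (f := fun y => G y * (M b * F y - M y))
    (fun x _ => ((hG x).mul (((hF' x).const_mul (M b)).sub (hM' x))).congr_deriv
      (show _ = g x * (M b * F x - M x) + (M b * (G x * f x) - G x ^ 2 * f x) by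
        simp only [Pi.sub_apply]; ring))
    ((hc1.add hc2).intervalIntegrable _ _)
  rw [intervalIntegral.integral_add (hc1.intervalIntegrable _ _) (hc2.intervalIntegrable _ _),
    intervalIntegral.integral_sub (Continuous.intervalIntegrable (by fun_prop) _ _)
      (Continuous.intervalIntegrable (by fun_prop) _ _),
    intervalIntegral.integral_const_mul, hFa, hFb, hMa] at key
  change _ + (M b * M b - _) = _ at key
  change _ = _ - M b ^ 2
  linear_combination key

theorem continuous_stdPhi : Continuous stdPhi := by
  unfold stdPhi
  fun_prop

theorem stdPhi_pos (x : ℝ) : 0 < stdPhi x := by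
  unfold stdPhi
  positivity

theorem integrable_stdPhi : Integrable stdPhi := by
  refine ((integrable_exp_neg_mul_sq (b := 1 / 2) (by norm_num)).const_mul
    (Real.sqrt (2 * Real.pi))⁻¹).congr (Filter.Eventually.of_forall fun x => ?_)
  simp only [stdPhi]
  ring_nf

theorem stdPhiCDF_sub (a b : ℝ) : stdPhiCDF b - stdPhiCDF a = ∫ t in a..b, stdPhi t :=
  intervalIntegral.integral_Iic_sub_Iic integrable_stdPhi.integrableOn integrable_stdPhi.integrableOn

theorem continuous_truncNormalPDF (μ σ τl τu : ℝ) : Continuous (truncNormalPDF μ σ τl τu) := by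
  have := continuous_stdPhi
  unfold truncNormalPDF
  fun_prop

theorem integral_truncNormalPDF {μ σ τl τu : ℝ} (hσ : 0 < σ) (h : τl < τu) :
    ∫ t in τl..τu, truncNormalPDF μ σ τl τu t = 1 := by
  have hlt : (τl - μ) / σ < (τu - μ) / σ := by gcongr
  have hpos : 0 < ∫ t in (τl - μ) / σ..(τu - μ) / σ, stdPhi t :=
    intervalIntegral.intervalIntegral_pos_of_pos (continuous_stdPhi.intervalIntegrable _ _) stdPhi_pos hlt
  have hsub : ∫ t in τl..τu, stdPhi ((t - μ) / σ) =
      σ * ∫ t in (τl - μ) / σ..(τu - μ) / σ, stdPhi t := by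
    simp only [sub_div]
    exact intervalIntegral.integral_comp_div_sub stdPhi hσ.ne' (μ / σ)
  simp only [truncNormalPDF, stdPhiCDF_sub]
  rw [intervalIntegral.integral_div, intervalIntegral.integral_const_mul, hsub]
  field_simp

/-- For `X ∼ TN(μ₀,σ₀,τ_l,τ_u)` with density `f` and CDF `F(t) = ∫_{τ_l}^t f`,
`∫_{τ_l}^{τ_u} ∫_{τ_l}^{τ_u} ((x−μ₀)/σ₀)((y−μ₀)/σ₀)(F(min(x,y)) − F(x)F(y)) dx dy
  = (σ₀²/4)(E[((X−μ₀)/σ₀)⁴] − (E[((X−μ₀)/σ₀)²])²)`,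
the variance of `(σ₀/2)((X−μ₀)/σ₀)²`. -/
theorem stmt16 (μ₀ σ₀ τl τu : ℝ) (hσ : 0 < σ₀) (h : τl < τu)
    (f : ℝ → ℝ) (hf : ∀ t : ℝ, f t = truncNormalPDF μ₀ σ₀ τl τu t)
    (F : ℝ → ℝ) (hF : ∀ t : ℝ, F t = ∫ s in τl..t, f s) :
    (∫ y in τl..τu, ∫ x in τl..τu,
        ((x - μ₀) / σ₀) * ((y - μ₀) / σ₀) * (F (min x y) - F x * F y)) =
      (σ₀ ^ 2 / 4) * ((∫ x in τl..τu, ((x - μ₀) / σ₀) ^ 4 * f x) -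
        (∫ x in τl..τu, ((x - μ₀) / σ₀) ^ 2 * f x) ^ 2) := by
  have hfc : Continuous f := by
    rw [funext hf]
    exact continuous_truncNormalPDF _ _ _ _
  have hFu : F τu = 1 := by
    rw [hF, funext hf]
    exact integral_truncNormalPDF hσ h
  have hG : ∀ x, HasDerivAt (fun x => σ₀ / 2 * ((x - μ₀) / σ₀) ^ 2) ((x - μ₀) / σ₀) x := by
    intro x
    refine (((((hasDerivAt_id' x).sub_const μ₀).div_const σ₀).pow 2).const_mul
      (σ₀ / 2)).congr_deriv ?_
    norm_num
    field_simp
  rw [integral_integral_mul_cdf_min_sub h.le hfc (by fun_prop) hG hF hFu]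
  have h4 : ∀ x, (σ₀ / 2 * ((x - μ₀) / σ₀) ^ 2) ^ 2 * f x =
      σ₀ ^ 2 / 4 * (((x - μ₀) / σ₀) ^ 4 * f x) := fun x => by ring
  simp only [h4, mul_assoc (σ₀ / 2), intervalIntegral.integral_const_mul]
  ring
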